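/- arXiv:1709.00121 — 4 statements merged into one kernel-verified Lean document; each statement's English description precedes it below -/
import Mathlib

section
/- Let k be a field of characteristic zero, M an n-dimensional k-vector space, and τ, p : M → M k-linear maps satisfying τ∘p − p∘τ = p∘p. If τ has n distinct eigenvalues in k, then p = 0. -/
open Polynomial in
/-- If `τ p - p τ = p²`, then `[τ, ·]` acts on polynomials in `p` as `p² d/dp`. -/
theorem commutator_aeval_of_commutator_eq_sq {k A : Type*} [CommRing k] [Ring A] [Algebra k A]
    {τ p : A} (h : τ * p - p * τ = p * p) (q : k[X]) :
    τ * aeval p q - aeval p q * τ = aeval p (X ^ 2 * derivative q) := by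
  have hpow (m : ℕ) : τ * p ^ m - p ^ m * τ = m * p ^ (m + 1) := by
    induction m with
    | zero => simp
    | succ m ih =>
      calc τ * p ^ (m + 1) - p ^ (m + 1) * τ
          = (τ * p ^ m - p ^ m * τ) * p + p ^ m * (τ * p - p * τ) := by
            rw [pow_succ]; noncomm_ring
        _ = ((m + 1 : ℕ) : A) * p ^ (m + 1 + 1) := by
            rw [ih, h, mul_assoc, ← pow_succ, ← mul_assoc, ← pow_succ, ← pow_succ]
            push_cast
            rw [add_mul, one_mul]
  induction q using Polynomial.induction_on' with
  | add f g hf hg =>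
    simp only [map_add, mul_add, add_mul] at hf hg ⊢
    rw [← hf, ← hg]
    abel
  | monomial m a =>
    have hX : (X ^ 2 * derivative (monomial m a) : k[X]) = monomial (m + 1) (a * m) := by
      cases m with
      | zero => simp
      | succ m => rw [derivative_monomial, X_pow_mul_monomial]; rfl
    rw [hX, aeval_monomial, aeval_monomial, ← mul_assoc, ← Algebra.commutes, mul_assoc, mul_assoc,
      ← mul_sub, hpow, map_mul, map_natCast, mul_assoc]

open Polynomial in
/-- In characteristic zero, an algebraic `p` with `τ p - p τ = p²` for some `τ` is nilpotent. -/
theorem isNilpotent_of_commutator_eq_sq {k A : Type*} [Field k] [CharZero k] [Ring A] [Algebra k A]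
    {τ p : A} (hp : IsIntegral k p) (h : τ * p - p * τ = p * p) : IsNilpotent p := by
  obtain ⟨r, hr, hnd⟩ :=
    exists_eq_pow_rootMultiplicity_mul_and_not_dvd (minpoly k p) (minpoly.ne_zero hp) 0
  generalize rootMultiplicity 0 (minpoly k p) = a at hr
  rw [C_0, sub_zero] at hr hnd
  have hdvd : minpoly k p ∣ X ^ 2 * derivative (minpoly k p) := by
    refine minpoly.dvd k p ?_
    rw [← commutator_aeval_of_commutator_eq_sq h, minpoly.aeval]
    simp
  have hcop (m : ℕ) : IsCoprime r (X ^ m) :=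
    ((irreducible_X.coprime_iff_not_dvd.mpr hnd).symm).pow_right
  have hrdvd : r ∣ derivative r := by
    have h1 : r ∣ X ^ 2 * derivative (X ^ a * r) := by
      rw [← hr]
      exact (Dvd.intro_left _ hr.symm).trans hdvd
    have h2 := (hcop 2).dvd_of_dvd_mul_left h1
    rw [derivative_mul] at h2
    exact (hcop a).dvd_of_dvd_mul_left ((dvd_add_right (dvd_mul_left _ _)).mp h2)
  have hdeg : r.natDegree = 0 := by
    by_contra hne
    have hd : derivative r = 0 := by
      by_contra hd
      exact (natDegree_derivative_lt hne).not_ge (natDegree_le_of_dvd hrdvd hd)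
    exact hne (derivative_eq_zero.mp hd)
  obtain ⟨c, rfl⟩ := natDegree_eq_zero.mp hdeg
  have hc : c ≠ 0 := by
    rintro rfl
    simp at hnd
  refine ⟨a, ?_⟩
  have h0 := minpoly.aeval k p
  rw [hr, map_mul, map_pow, aeval_X, aeval_C, ← Algebra.commutes, ← Algebra.smul_def] at h0
  simpa [smul_smul, hc] using congrArg (c⁻¹ • ·) h0

/-- Two vectors in the same eigenspace of an endomorphism that is diagonal in a basis with
pairwise distinct eigenvalues are proportional. -/
theorem exists_smul_eq_of_mem_eigenspace {ι k M : Type*} [Field k] [AddCommGroup M] [Module k M]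
    {τ : Module.End k M} {μ : ι → k} (hinj : Function.Injective μ) (b : Module.Basis ι k M)
    (hb : ∀ i, τ (b i) = μ i • b i) {l : k} {v w : M} (hv : τ v = l • v) (hw : τ w = l • w)
    (hv0 : v ≠ 0) : ∃ c : k, w = c • v := by
  have hcoord (x : M) (i : ι) : b.repr (τ x) i = μ i * b.repr x i := by
    have : b.coord i ∘ₗ τ = μ i • b.coord i := by
      refine b.ext fun j => ?_
      by_cases hij : j = i
      · subst hij; simp [hb]
      · simp [hb, hij]
    simpa using LinearMap.congr_fun this x
  have hzero {x : M} (hx : τ x = l • x) {i : ι} (hi : μ i ≠ l) : b.repr x i = 0 := by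
    have := hcoord x i
    rw [hx, map_smul, Finsupp.smul_apply, smul_eq_mul] at this
    by_contra hne
    exact hi (mul_right_cancel₀ hne this).symm
  obtain ⟨i, hi⟩ : ∃ i, b.repr v i ≠ 0 := by
    by_contra! hall
    exact hv0 (b.repr.map_eq_zero_iff.mp (Finsupp.ext hall))
  have hil : μ i = l := by
    by_contra hne
    exact hi (hzero hv hne)
  refine ⟨b.repr w i / b.repr v i, b.ext_elem fun j => ?_⟩
  by_cases hj : j = i
  · subst hj; simp [hi]
  · have hjl : μ j ≠ l := fun e => hj (hinj (e.trans hil.symm))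
    simp [hzero hv hjl, hzero hw hjl]

theorem stmt_9 (k : Type*) [Field k] [CharZero k] (M : Type*) [AddCommGroup M]
    [Module k M] [FiniteDimensional k M] (n : ℕ) (hdim : Module.finrank k M = n)
    (τ p : Module.End k M) (h : τ * p - p * τ = p * p)
    (μ : Fin n → k) (hinj : Function.Injective μ)
    (heig : ∀ i, Module.End.HasEigenvalue τ (μ i)) : p = 0 := by
  choose v hv using fun i => (heig i).exists_hasEigenvector
  have hli : LinearIndependent k v := Module.End.eigenvectors_linearIndependent' τ μ hinj v hv
  have hspan : Submodule.span k (Set.range v) = ⊤ :=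
    hli.span_eq_top_of_card_eq_finrank' (by simp [hdim])
  let b := Module.Basis.mk hli hspan.ge
  have hb (i : Fin n) : τ (b i) = μ i • b i := by
    simpa [b] using (hv i).apply_eq_smul
  have htop : ⨆ l, τ.eigenspace l = ⊤ := by
    rw [eq_top_iff, ← hspan, Submodule.span_le]
    rintro _ ⟨i, rfl⟩
    exact Submodule.mem_iSup_of_mem (μ i) (hv i).1
  have hcomm (x : M) : τ (p x) = p (τ x) + p (p x) := by
    have := LinearMap.congr_fun h x
    simp only [LinearMap.sub_apply, Module.End.mul_apply] at this
    rw [← this]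
    abel
  have hker (x : M) (hx : p (p x) = 0) : p x = 0 := by
    have hinv : ∀ x ∈ LinearMap.ker (p * p), τ x ∈ LinearMap.ker (p * p) := by
      intro x hx
      simp only [LinearMap.mem_ker, Module.End.mul_apply] at hx ⊢
      have h1 : p (τ x) = τ (p x) := by rw [hcomm, hx, add_zero]
      have h2 := hcomm (p x)
      rw [hx, map_zero, map_zero, add_zero] at h2
      rw [h1, ← h2]
    have hle : LinearMap.ker (p * p) ≤ LinearMap.ker p := by
      rw [Submodule.eq_iSup_inf_genEigenspace 1 hinv htop]
      refine iSup_le fun l w hw => ?_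
      have hpp : p (p w) = 0 := hw.1
      have hw1 : τ w = l • w := Module.End.mem_eigenspace_iff.mp hw.2
      by_cases hw0 : w = 0
      · simp [hw0]
      have hpw : τ (p w) = l • p w := by rw [hcomm, hpp, add_zero, hw1, map_smul]
      obtain ⟨c, hc⟩ := exists_smul_eq_of_mem_eigenspace hinj b hb hw1 hpw hw0
      rw [LinearMap.mem_ker]
      rw [hc, map_smul, smul_eq_zero] at hpp
      rcases hpp with rfl | hpp
      · rw [hc, zero_smul]
      · exact hpp
    exact hle hx
  obtain ⟨N, hN⟩ := isNilpotent_of_commutator_eq_sq (Algebra.IsIntegral.isIntegral (R := k) p) h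
  have hpow (m : ℕ) (x : M) : (p ^ m) x = 0 → p x = 0 := by
    induction m generalizing x with
    | zero => intro hx; simp_all
    | succ m ih =>
      intro hx
      rw [pow_succ, Module.End.mul_apply] at hx
      exact hker x (ih (p x) hx)
  exact LinearMap.ext fun x => hpow N x (by simp [hN])
end

section
/- Let k be a field of characteristic zero, n ≥ 1, and let J ∈ M_n(k) be the nilpotent Jordan block (ones on the superdiagonal, zeros elsewhere). If B, C ∈ M_n(k) both satisfy JB − BJ = B² and JC − CJ = C², and their last columns coincide, i.e., B_{i,n} = C_{i,n} for all 1 ≤ i ≤ n, then B = C. (Equivalently: a solution B of JB − BJ = B² is completely determined by its n-th column.) -/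
section JordanBlock

variable {k : Type*} [Field k] {n : ℕ} {J B : Matrix (Fin n) (Fin n) k}

theorem jordanBlock_pow_apply (hJ : ∀ i j : Fin n, J i j = if (i : ℕ) + 1 = (j : ℕ) then 1 else 0)
    (m : ℕ) (i j : Fin n) : (J ^ m) i j = if (i : ℕ) + m = (j : ℕ) then 1 else 0 := by
  induction m generalizing j with
  | zero => simp [Matrix.one_apply, Fin.ext_iff]
  | succ m ih =>
    rw [pow_succ, Matrix.mul_apply]
    simp only [ih, hJ, ite_mul, one_mul, zero_mul]
    by_cases h : (i : ℕ) + m < n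
    · rw [Finset.sum_eq_single ⟨i + m, h⟩]
      · simp [add_assoc]
      · intro l _ hl
        rw [if_neg]
        exact fun h' => hl (Fin.ext h'.symm)
      · simp
    · rw [if_neg (by omega)]
      refine Finset.sum_eq_zero fun l _ => if_neg (by omega)

theorem isNilpotent_jordanBlock
    (hJ : ∀ i j : Fin n, J i j = if (i : ℕ) + 1 = (j : ℕ) then 1 else 0) : IsNilpotent J := by
  refine ⟨n, ?_⟩
  ext i j
  rw [jordanBlock_pow_apply hJ, if_neg (by omega), Matrix.zero_apply]

theorem commutator_pow_of_commutator_eq_sq {R : Type*} [Ring R] {x y : R}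
    (h : x * y - y * x = y ^ 2) (m : ℕ) : x * y ^ m - y ^ m * x = m • y ^ (m + 1) := by
  induction m with
  | zero => simp
  | succ m ih =>
    calc x * y ^ (m + 1) - y ^ (m + 1) * x
        = (x * y ^ m - y ^ m * x) * y + y ^ m * (x * y - y * x) := by
          rw [pow_succ]; noncomm_ring
      _ = (m + 1) • y ^ (m + 1 + 1) := by
          rw [ih, h, smul_mul_assoc, ← pow_succ, ← pow_add, succ_nsmul]

theorem isNilpotent_of_commutator_eq_sq_s14 [CharZero k] (hJ : IsNilpotent J)
    (h : J * B - B * J = B ^ 2) : IsNilpotent B := by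
  have had : IsNilpotent (LinearMap.mulLeft k J - LinearMap.mulRight k J) :=
    (LinearMap.commute_mulLeft_right J J).isNilpotent_sub
      ((LinearMap.isNilpotent_mulLeft_iff k J).mpr hJ)
      ((LinearMap.isNilpotent_mulRight_iff k J).mpr hJ)
  obtain ⟨N, hN⟩ := had
  have key (m : ℕ) : ((LinearMap.mulLeft k J - LinearMap.mulRight k J) ^ m) B =
      m.factorial • B ^ (m + 1) := by
    induction m with
    | zero => simp
    | succ m ih =>
      rw [pow_succ', Module.End.mul_apply, ih, map_nsmul, LinearMap.sub_apply,
        LinearMap.mulLeft_apply, LinearMap.mulRight_apply,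
        commutator_pow_of_commutator_eq_sq h, smul_smul, Nat.factorial_succ, mul_comm]
  refine ⟨N + 1, ?_⟩
  have := key N
  rw [hN, LinearMap.zero_apply, ← Nat.cast_smul_eq_nsmul k] at this
  exact (smul_eq_zero.mp this.symm).resolve_left
    (Nat.cast_ne_zero.mpr (Nat.factorial_ne_zero N))

theorem jordanBlock_mul_apply
    (hJ : ∀ i j : Fin n, J i j = if (i : ℕ) + 1 = (j : ℕ) then 1 else 0)
    (A : Matrix (Fin n) (Fin n) k) {i i' : Fin n} (hi : (i : ℕ) + 1 = i') (j : Fin n) :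
    (J * A) i j = A i' j := by
  rw [Matrix.mul_apply, Finset.sum_eq_single i']
  · simp [hJ, hi]
  · intro l _ hl
    rw [hJ, if_neg (fun h => hl (Fin.ext (by omega))), zero_mul]
  · simp

theorem mul_jordanBlock_apply
    (hJ : ∀ i j : Fin n, J i j = if (i : ℕ) + 1 = (j : ℕ) then 1 else 0)
    (A : Matrix (Fin n) (Fin n) k) {j j' : Fin n} (hj : (j : ℕ) + 1 = j') (i : Fin n) :
    (A * J) i j' = A i j := by
  rw [Matrix.mul_apply, Finset.sum_eq_single j]
  · simp [hJ, hj]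
  · intro l _ hl
    rw [hJ, if_neg (fun h => hl (Fin.ext (by omega))), mul_zero]
  · simp

theorem mul_jordanBlock_apply_zero
    (hJ : ∀ i j : Fin n, J i j = if (i : ℕ) + 1 = (j : ℕ) then 1 else 0)
    (A : Matrix (Fin n) (Fin n) k) {j : Fin n} (hj : (j : ℕ) = 0) (i : Fin n) :
    (A * J) i j = 0 := by
  rw [Matrix.mul_apply]
  exact Finset.sum_eq_zero fun l _ => by rw [hJ, if_neg (by omega), mul_zero]

/-- If the first `j` columns of `B` are strictly upper triangular, then the powers of `B` preserve the
span of the first `j` basis vectors. -/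
theorem pow_apply_eq_zero_of_lt {j : ℕ}
    (hB : ∀ i l : Fin n, (l : ℕ) < j → l ≤ i → B i l = 0) (m : ℕ) (i l : Fin n)
    (hl : (l : ℕ) < j) (hi : j ≤ i) : (B ^ m) i l = 0 := by
  induction m generalizing l with
  | zero => rw [pow_zero, Matrix.one_apply_ne]; rintro rfl; omega
  | succ m ih =>
    rw [pow_succ, Matrix.mul_apply]
    refine Finset.sum_eq_zero fun p _ => ?_
    by_cases hp : (p : ℕ) < j
    · rw [ih p hp, zero_mul]
    · rw [hB p l hl (by rw [Fin.le_def]; omega), mul_zero]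

/-- If the entries of a nilpotent matrix below and to the left of the `j`-th diagonal entry vanish,
then so does that diagonal entry. -/
theorem diag_eq_zero_of_isNilpotent {A : Matrix (Fin n) (Fin n) k} (hA : IsNilpotent A)
    (j : Fin n) (hlow : ∀ i l : Fin n, l < j → j ≤ i → A i l = 0)
    (hcol : ∀ i : Fin n, j < i → A i j = 0) : A j j = 0 := by
  have key (m : ℕ) : (A ^ m) j j = A j j ^ m ∧ ∀ i : Fin n, j < i → (A ^ m) i j = 0 := by
    induction m with
    | zero => exact ⟨by simp, fun i hi => by rw [pow_zero, Matrix.one_apply_ne hi.ne']⟩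
    | succ m ih =>
      constructor
      · rw [pow_succ', Matrix.mul_apply, Finset.sum_eq_single j, ih.1, pow_succ']
        · intro l _ hl
          rcases lt_or_gt_of_ne hl with h | h
          · rw [hlow j l h le_rfl, zero_mul]
          · rw [ih.2 l h, mul_zero]
        · simp
      · intro i hi
        rw [pow_succ', Matrix.mul_apply]
        refine Finset.sum_eq_zero fun l _ => ?_
        rcases lt_trichotomy l j with h | rfl | h
        · rw [hlow i l h hi.le, zero_mul]
        · rw [hcol i hi, zero_mul]
        · rw [ih.2 l h, mul_zero]
  obtain ⟨N, hN⟩ := hA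
  have := (key N).1
  rw [hN, Matrix.zero_apply] at this
  exact IsReduced.eq_zero _ ⟨N, this.symm⟩

theorem strictUpper_of_commutator_eq_sq [CharZero k]
    (hJ : ∀ i j : Fin n, J i j = if (i : ℕ) + 1 = (j : ℕ) then 1 else 0)
    (h : J * B - B * J = B ^ 2) (i j : Fin n) (hij : j ≤ i) : B i j = 0 := by
  have hnil := isNilpotent_of_commutator_eq_sq_s14 (isNilpotent_jordanBlock hJ) h
  suffices H : ∀ c : ℕ, ∀ i j : Fin n, (j : ℕ) < c → j ≤ i → B i j = 0 from
    H (j + 1) i j (Nat.lt_succ_self _) hij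
  intro c
  induction c with
  | zero => intro i j hj; omega
  | succ c ih =>
    intro i j hj hij
    rcases Nat.lt_succ_iff_lt_or_eq.mp hj with hj | hj
    · exact ih i j hj hij
    have hpow (m : ℕ) (i l : Fin n) (hl : l < j) (hi : j ≤ i) : (B ^ m) i l = 0 :=
      pow_apply_eq_zero_of_lt ih m i l (by rw [Fin.lt_def] at hl; omega)
        (by rw [Fin.le_def] at hi; omega)
    have hBJ (m : ℕ) (i : Fin n) (hi : j ≤ i) : (B ^ m * J) i j = 0 := by
      rcases Nat.eq_zero_or_pos (j : ℕ) with h0 | h0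
      · exact mul_jordanBlock_apply_zero hJ _ h0 i
      · rw [mul_jordanBlock_apply hJ (B ^ m) (j := ⟨j - 1, by omega⟩) (by simp only; omega)]
        exact hpow m i _ (by rw [Fin.lt_def]; simp only; omega) hi
    -- descend from a vanishing power of `B` to `B` itself
    have hstep (m : ℕ) (hm : 1 ≤ m) (hz : ∀ i, j ≤ i → (B ^ (m + 1)) i j = 0) :
        ∀ i, j ≤ i → (B ^ m) i j = 0 := by
      have hcol : ∀ i, j < i → (B ^ m) i j = 0 := by
        intro i hi
        rw [Fin.lt_def] at hi
        have hi' : j ≤ (⟨i - 1, by omega⟩ : Fin n) := by rw [Fin.le_def]; simp only; omega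
        have e := congrFun (congrFun (commutator_pow_of_commutator_eq_sq h m) ⟨i - 1, by omega⟩) j
        rw [Matrix.sub_apply, hBJ m _ hi', sub_zero, Matrix.smul_apply, hz _ hi', smul_zero,
          jordanBlock_mul_apply hJ (B ^ m) (i' := i) (by simp only; omega)] at e
        exact e
      intro i hi
      rcases hi.lt_or_eq with hi | rfl
      · exact hcol i hi
      · exact diag_eq_zero_of_isNilpotent (hnil.pow_of_pos (by omega)) j (hpow m) hcol
    obtain ⟨N, hN⟩ := hnil
    have hall (t : ℕ) : ∀ m, 1 ≤ m → N ≤ m + t → ∀ i, j ≤ i → (B ^ m) i j = 0 := by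
      induction t with
      | zero =>
        intro m _ hm i _
        rw [pow_eq_zero_of_le (show N ≤ m from hm) hN, Matrix.zero_apply]
      | succ t iht => exact fun m h1 hm => hstep m h1 (iht (m + 1) (by omega) (by omega))
    simpa using hall N 1 le_rfl (by omega) i hij

/-- The recursion along superdiagonals satisfied by a strictly upper triangular solution. -/
theorem superdiagonal_recursion [CharZero k]
    (hJ : ∀ i j : Fin n, J i j = if (i : ℕ) + 1 = (j : ℕ) then 1 else 0)
    (h : J * B - B * J = B ^ 2) {i i' j j' : Fin n} (hi : (i : ℕ) + 1 = i')
    (hj : (j : ℕ) + 1 = j') (hij : i < j) :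
    B i j * (1 + B j j') = B i' j' - ∑ l ∈ Finset.Ioo i j, B i l * B l j' := by
  have hU := strictUpper_of_commutator_eq_sq hJ h
  have e := congrFun (congrFun h i) j'
  rw [Matrix.sub_apply, jordanBlock_mul_apply hJ B hi, mul_jordanBlock_apply hJ B hj, pow_two,
    Matrix.mul_apply] at e
  have hsum : ∑ l, B i l * B l j' = ∑ l ∈ Finset.Ioc i j, B i l * B l j' := by
    refine (Finset.sum_subset (Finset.subset_univ _) fun l _ hl => ?_).symm
    rw [Finset.mem_Ioc, not_and_or, not_lt, not_le] at hl
    rcases hl with hl | hl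
    · rw [hU i l hl, zero_mul]
    · rw [hU l j' (by rw [Fin.le_def]; rw [Fin.lt_def] at hl; omega), mul_zero]
  rw [hsum, ← Finset.Ioo_insert_right hij, Finset.sum_insert (by simp)] at e
  linear_combination -e

theorem one_add_superdiagonal_ne_zero [CharZero k]
    (hJ : ∀ i j : Fin n, J i j = if (i : ℕ) + 1 = (j : ℕ) then 1 else 0)
    (h : J * B - B * J = B ^ 2) {j j' : Fin n} (hj : (j : ℕ) + 1 = j') (h0 : 0 < (j : ℕ)) :
    1 + B j j' ≠ 0 := by
  intro hz
  have hi : ((⟨j - 1, by omega⟩ : Fin n) : ℕ) + 1 = j := by simp only; omega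
  have e := superdiagonal_recursion hJ h hi hj (by rw [Fin.lt_def]; omega)
  rw [Finset.sum_eq_zero, hz, mul_zero, sub_zero] at e
  · rw [← e, add_zero] at hz
    exact one_ne_zero hz
  · intro l hl
    rw [Finset.mem_Ioo, Fin.lt_def, Fin.lt_def] at hl
    omega

end JordanBlock

theorem stmt_14 (k : Type*) [Field k] [CharZero k] (n : ℕ) (hn : 1 ≤ n)
    (J B C : Matrix (Fin n) (Fin n) k)
    (hJ : ∀ i j : Fin n, J i j = if (i : ℕ) + 1 = (j : ℕ) then 1 else 0)
    (hB : J * B - B * J = B ^ 2) (hC : J * C - C * J = C ^ 2)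
    (hlast : ∀ i : Fin n, B i ⟨n - 1, by omega⟩ = C i ⟨n - 1, by omega⟩) :
    B = C := by
  suffices H : ∀ d t : ℕ, ∀ i j : Fin n, (i : ℕ) + d = j → (j : ℕ) + t + 1 = n →
      B i j = C i j by
    ext i j
    rcases le_or_gt j i with hij | hij
    · rw [strictUpper_of_commutator_eq_sq hJ hB i j hij,
        strictUpper_of_commutator_eq_sq hJ hC i j hij]
    · rw [Fin.lt_def] at hij
      exact H (j - i) (n - 1 - j) i j (by omega) (by omega)
  intro d
  induction d using Nat.strong_induction_on with
  | _ d ihd =>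
    intro t
    induction t with
    | zero =>
      intro i j _ hj
      have : j = ⟨n - 1, by omega⟩ := Fin.ext (by simp only; omega)
      rw [this, hlast]
    | succ t iht =>
      intro i j hij hj
      rcases Nat.eq_zero_or_pos d with rfl | hd
      · have hle : j ≤ i := by rw [Fin.le_def]; omega
        rw [strictUpper_of_commutator_eq_sq hJ hB i j hle,
          strictUpper_of_commutator_eq_sq hJ hC i j hle]
      obtain ⟨i', hi'⟩ : ∃ i' : Fin n, (i : ℕ) + 1 = i' := ⟨⟨i + 1, by omega⟩, rfl⟩
      obtain ⟨j', hj'⟩ : ∃ j' : Fin n, (j : ℕ) + 1 = j' := ⟨⟨j + 1, by omega⟩, rfl⟩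
      have hlt : i < j := by rw [Fin.lt_def]; omega
      have hnext (l : Fin n) (hl : i < l) (hl' : l ≤ j) : B l j' = C l j' := by
        rw [Fin.lt_def] at hl
        rw [Fin.le_def] at hl'
        rcases Nat.lt_or_ge ((j' : ℕ) - l) d with h | h
        · exact ihd (j' - l) h t l j' (by omega) (by omega)
        · exact iht l j' (by omega) (by omega)
      have eB := superdiagonal_recursion hJ hB hi' hj' hlt
      have eC := superdiagonal_recursion hJ hC hi' hj' hlt
      have hsum : ∑ l ∈ Finset.Ioo i j, B i l * B l j' =
          ∑ l ∈ Finset.Ioo i j, C i l * C l j' := by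
        refine Finset.sum_congr rfl fun l hl => ?_
        rw [Finset.mem_Ioo] at hl
        rw [hnext l hl.1 hl.2.le]
        rw [Fin.lt_def, Fin.lt_def] at hl
        rw [ihd (l - i) (by omega) (n - 1 - l) i l (by omega) (by omega)]
      rw [hsum, hnext i' (by rw [Fin.lt_def]; omega) (by rw [Fin.le_def]; omega), ← eC,
        hnext j hlt le_rfl] at eB
      exact mul_right_cancel₀ (one_add_superdiagonal_ne_zero hJ hC hj' (by omega)) eB
end

section
/- Let k be a field of characteristic zero, n ≥ 3, and let J ∈ M_n(k) be the nilpotent Jordan block (ones on the superdiagonal, zeros elsewhere). Let B ∈ M_n(k) satisfy JB − BJ = B², and suppose i is an integer with ⌊(n−1)/2⌋ < i ≤ n−1 such that B_{n−j,n} = 0 for all 1 ≤ j ≤ i−1 and B_{n−i,n} ≠ 0. Then B = Σ_{j=i}^{n−1} B_{n−j,n} · J^j, i.e., B is the polynomial B_{n−i,n}·J^i + B_{n−i−1,n}·J^{i+1} + ⋯ + B_{1,n}·J^{n−1} in J. -/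
namespace JordanBlock

variable {k : Type*} [Field k] {n : ℕ} {J B : Matrix (Fin n) (Fin n) k}

lemma pow_apply (hJ : ∀ i j : Fin n, J i j = if (i : ℕ) + 1 = (j : ℕ) then 1 else 0)
    (s : ℕ) (r c : Fin n) : (J ^ s) r c = if (r : ℕ) + s = (c : ℕ) then 1 else 0 := by
  induction s generalizing r with
  | zero => simp [Matrix.one_apply, Fin.ext_iff]
  | succ s ih =>
    rw [pow_succ', Matrix.mul_apply]
    simp only [hJ, ih, ite_mul, one_mul, zero_mul]
    by_cases h : (r : ℕ) + 1 < n
    · rw [Finset.sum_eq_single ⟨r + 1, h⟩]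
      · simp [add_assoc, add_comm 1 s]
      · intro b _ hb
        rw [if_neg]
        exact fun h' => hb (Fin.ext h'.symm)
      · simp
    · have := c.2
      rw [if_neg (by omega)]
      exact Finset.sum_eq_zero fun b _ => if_neg (by have := b.2; omega)

lemma pow_mulVec (hJ : ∀ i j : Fin n, J i j = if (i : ℕ) + 1 = (j : ℕ) then 1 else 0)
    (s : ℕ) (u : Fin n → k) (r : Fin n) :
    (J ^ s).mulVec u r = if h : (r : ℕ) + s < n then u ⟨r + s, h⟩ else 0 := by
  simp only [Matrix.mulVec, dotProduct, pow_apply hJ, ite_mul, one_mul, zero_mul]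
  split_ifs with h
  · rw [Finset.sum_eq_single ⟨r + s, h⟩]
    · simp
    · intro b _ hb
      rw [if_neg]
      exact fun h' => hb (Fin.ext h'.symm)
    · simp
  · exact Finset.sum_eq_zero fun b _ => if_neg (by have := b.2; omega)

lemma mul_apply_left (hJ : ∀ i j : Fin n, J i j = if (i : ℕ) + 1 = (j : ℕ) then 1 else 0)
    (A : Matrix (Fin n) (Fin n) k) (r c : Fin n) :
    (J * A) r c = if h : (r : ℕ) + 1 < n then A ⟨r + 1, h⟩ c else 0 := by
  have := pow_mulVec hJ 1 (fun t => A t c) r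
  rwa [pow_one] at this

lemma mul_apply_right (hJ : ∀ i j : Fin n, J i j = if (i : ℕ) + 1 = (j : ℕ) then 1 else 0)
    (A : Matrix (Fin n) (Fin n) k) (r : Fin n) (c : ℕ) (hc : c + 1 < n) :
    (A * J) r ⟨c + 1, hc⟩ = A r ⟨c, by omega⟩ := by
  rw [Matrix.mul_apply, Finset.sum_eq_single ⟨c, by omega⟩]
  · simp [hJ]
  · intro b _ hb
    rw [hJ, if_neg, mul_zero]
    exact fun h' => hb (Fin.ext (by simpa using h'))
  · simp

lemma isNilpotent (hJ : ∀ i j : Fin n, J i j = if (i : ℕ) + 1 = (j : ℕ) then 1 else 0) :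
    IsNilpotent J := by
  refine ⟨n, ?_⟩
  ext r c
  rw [pow_apply hJ, if_neg (by have := c.2; omega), Matrix.zero_apply]

/-- A subspace stable under the Jordan block contains every basis vector below the position of a
nonzero coordinate of one of its elements. -/
lemma single_mem (hJ : ∀ i j : Fin n, J i j = if (i : ℕ) + 1 = (j : ℕ) then 1 else 0)
    (W : Submodule k (Fin n → k)) (hW : ∀ w ∈ W, J.mulVec w ∈ W)
    {u : Fin n → k} (hu : u ∈ W) {t : Fin n} (ht : u t ≠ 0) {c : Fin n} (hc : c ≤ t) :
    Pi.single c (1 : k) ∈ W := by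
  classical
  obtain ⟨m, hm, hmax⟩ := Finset.exists_max_image (Finset.univ.filter fun t => u t ≠ 0) id
    ⟨t, by simpa using ht⟩
  simp only [Finset.mem_filter, Finset.mem_univ, true_and, id] at hm hmax
  have hpow : ∀ s, (J ^ s).mulVec u ∈ W := by
    intro s
    induction s with
    | zero => simpa using hu
    | succ s ih =>
      rw [pow_succ', ← Matrix.mulVec_mulVec]
      exact hW _ ih
  have hcm : c ≤ m := hc.trans (hmax t ht)
  clear hc
  induction c using WellFoundedLT.induction with
  | ind c ih =>
    have hcm' : (c : ℕ) ≤ m := hcm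
    set w := (J ^ ((m : ℕ) - c)).mulVec u with hw
    have hwc : w c = u m := by
      have h : (c : ℕ) + (m - c) = m := by omega
      simp [hw, pow_mulVec hJ, h]
    have hwr : ∀ r, c < r → w r = 0 := by
      intro r hr
      have hr' : (c : ℕ) < r := hr
      rw [hw, pow_mulVec hJ]
      split_ifs with h
      · by_contra hne
        have : (r : ℕ) + (m - c) ≤ m := hmax _ hne
        omega
      · rfl
    have hsum : w = ∑ r, w r • Pi.single r (1 : k) := pi_eq_sum_univ' w
    rw [← Finset.add_sum_erase _ _ (Finset.mem_univ c)] at hsum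
    have hrest : ∑ r ∈ Finset.univ.erase c, w r • (Pi.single r (1 : k) : Fin n → k) ∈ W := by
      refine Submodule.sum_mem _ fun r hr => ?_
      rcases lt_or_gt_of_ne (Finset.ne_of_mem_erase hr) with h | h
      · exact W.smul_mem _ (ih r h (h.le.trans hcm))
      · simp [hwr r h]
    have hmem : w c • (Pi.single c (1 : k) : Fin n → k) ∈ W := by
      rw [← sub_eq_iff_eq_add.2 hsum]
      exact W.sub_mem (hpow _) hrest
    exact (W.smul_mem_iff (hwc ▸ hm)).1 hmem

end JordanBlock

section Commutator

variable {A : Type*} [Ring A] {x y : A}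

lemma mul_pow_sub_pow_mul_of_commutator_eq_sq (h : x * y - y * x = y ^ 2) (m : ℕ) :
    x * y ^ m - y ^ m * x = m * y ^ (m + 1) := by
  induction m with
  | zero => simp
  | succ m ih =>
    have e : x * y ^ (m + 1) - y ^ (m + 1) * x =
        (x * y ^ m - y ^ m * x) * y + y ^ m * (x * y - y * x) := by
      rw [pow_succ]; noncomm_ring
    rw [e, ih, h, mul_assoc, ← pow_succ, ← pow_add]
    push_cast
    rw [add_mul, one_mul]

lemma isNilpotent_of_commutator_eq_sq_s16 [Algebra ℚ A]
    (hx : IsNilpotent x) (h : x * y - y * x = y ^ 2) : IsNilpotent y := by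
  have key : ∀ s : ℕ, ((LinearMap.mulLeft ℚ x - LinearMap.mulRight ℚ x) ^ s) y =
      (s.factorial : ℚ) • y ^ (s + 1) := by
    intro s
    induction s with
    | zero => simp
    | succ s ih =>
      rw [pow_succ', Module.End.mul_apply, ih, map_smul, LinearMap.sub_apply,
        LinearMap.mulLeft_apply, LinearMap.mulRight_apply,
        mul_pow_sub_pow_mul_of_commutator_eq_sq h, Nat.factorial_succ, Nat.cast_mul, mul_comm,
        mul_smul, Nat.cast_smul_eq_nsmul ℚ (s + 1), nsmul_eq_mul]
  obtain ⟨s, hs⟩ := (LinearMap.commute_mulLeft_right (R := ℚ) x x).isNilpotent_sub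
    ((LinearMap.isNilpotent_mulLeft_iff ℚ x).2 hx) ((LinearMap.isNilpotent_mulRight_iff ℚ x).2 hx)
  refine ⟨s + 1, ?_⟩
  have := key s
  rw [hs, LinearMap.zero_apply] at this
  exact (smul_eq_zero.1 this.symm).resolve_left (by exact_mod_cast s.factorial_ne_zero)

end Commutator

namespace JordanBlock

variable {k : Type*} [Field k] {n : ℕ} {J B : Matrix (Fin n) (Fin n) k}

lemma apply_eq_zero_of_le [CharZero k]
    (hJ : ∀ i j : Fin n, J i j = if (i : ℕ) + 1 = (j : ℕ) then 1 else 0)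
    (hB : J * B - B * J = B ^ 2) {r c : Fin n} (hrc : c ≤ r) : B r c = 0 := by
  classical
  by_contra hne
  have hnil : ∃ m, (B ^ m).mulVec (Pi.single c 1) = 0 := by
    obtain ⟨m, hm⟩ := isNilpotent_of_commutator_eq_sq_s16 (isNilpotent hJ) hB
    exact ⟨m, by rw [hm, Matrix.zero_mulVec]⟩
  have hspec := Nat.find_spec hnil
  have hmin := fun m => Nat.find_min hnil (m := m)
  generalize Nat.find hnil = m at hspec hmin
  cases m with
  | zero =>
    rw [pow_zero, Matrix.one_mulVec] at hspec
    simpa using congrFun hspec c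
  | succ m =>
    refine hmin m m.lt_succ_self ?_
    have hW : ∀ w ∈ LinearMap.ker (B ^ m).mulVecLin,
        J.mulVec w ∈ LinearMap.ker (B ^ m).mulVecLin := by
      intro w hw
      rw [LinearMap.mem_ker, Matrix.mulVecLin_apply] at hw ⊢
      have e : B ^ m * J = J * B ^ m - m * (B * B ^ m) := by
        rw [← pow_succ', ← mul_pow_sub_pow_mul_of_commutator_eq_sq hB]
        abel
      rw [Matrix.mulVec_mulVec, e, Matrix.sub_mulVec, ← mul_assoc, ← Matrix.mulVec_mulVec,
        ← Matrix.mulVec_mulVec, hw]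
      simp
    have hu : B.mulVec (Pi.single c 1) ∈ LinearMap.ker (B ^ m).mulVecLin := by
      rw [LinearMap.mem_ker, Matrix.mulVecLin_apply, Matrix.mulVec_mulVec, ← pow_succ]
      exact hspec
    have := single_mem hJ _ hW hu (t := r) (by simpa using hne) hrc
    rwa [LinearMap.mem_ker, Matrix.mulVecLin_apply] at this

lemma apply_eq_zero_of_lt_add [CharZero k]
    (hJ : ∀ i j : Fin n, J i j = if (i : ℕ) + 1 = (j : ℕ) then 1 else 0)
    (hB : J * B - B * J = B ^ 2) {i : ℕ}
    (hlast : ∀ r c : Fin n, (c : ℕ) = n - 1 → (c : ℕ) < r + i → B r c = 0)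
    (r c : Fin n) (h : (c : ℕ) < r + i) : B r c = 0 := by
  obtain ⟨s, hs⟩ : ∃ s, s = n - 1 - (c : ℕ) := ⟨_, rfl⟩
  induction s generalizing r c with
  | zero => exact hlast r c (by omega) h
  | succ s ih =>
    have hc : (c : ℕ) + 1 < n := by omega
    have e := congrFun (congrFun hB r) ⟨c + 1, hc⟩
    rw [Matrix.sub_apply, mul_apply_right hJ, mul_apply_left hJ] at e
    have hsq : (B ^ 2) r ⟨c + 1, hc⟩ = 0 := by
      rw [sq, Matrix.mul_apply]
      refine Finset.sum_eq_zero fun t _ => ?_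
      rcases le_or_gt t r with htr | htr
      · rw [apply_eq_zero_of_le hJ hB htr, zero_mul]
      · have : (r : ℕ) < t := htr
        rw [ih t ⟨c + 1, hc⟩ (by simp only; omega) (by simp only; omega), mul_zero]
    have hleft : (if h : (r : ℕ) + 1 < n then B ⟨r + 1, h⟩ ⟨c + 1, hc⟩ else 0) = 0 := by
      split_ifs with hr
      · exact ih _ _ (by simp only; omega) (by simp only; omega)
      · rfl
    rw [hsq, hleft, zero_sub, neg_eq_zero] at e
    exact e

lemma apply_add_eq_of_commute
    (hJ : ∀ i j : Fin n, J i j = if (i : ℕ) + 1 = (j : ℕ) then 1 else 0)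
    (hB : J * B = B * J) (s r c : ℕ) (hr : r + s < n) (hc : c + s < n) :
    B ⟨r + s, hr⟩ ⟨c + s, hc⟩ = B ⟨r, by omega⟩ ⟨c, by omega⟩ := by
  induction s with
  | zero => rfl
  | succ s ih =>
    have e := congrFun (congrFun hB ⟨r + s, by omega⟩) ⟨c + s + 1, hc⟩
    rw [mul_apply_right hJ, mul_apply_left hJ, dif_pos (show r + s + 1 < n from hr)] at e
    exact e.trans (ih _ _)

end JordanBlock

theorem stmt_16 (k : Type*) [Field k] [CharZero k] (n : ℕ) (hn : 3 ≤ n)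
    (J B : Matrix (Fin n) (Fin n) k)
    (hJ : ∀ i j : Fin n, J i j = if (i : ℕ) + 1 = (j : ℕ) then 1 else 0)
    (hB : J * B - B * J = B ^ 2)
    (i : ℕ) (hi1 : (n - 1) / 2 < i) (hi2 : i ≤ n - 1)
    (hzero : ∀ j : ℕ, 1 ≤ j → j ≤ i - 1 →
      B ⟨n - j - 1, by omega⟩ ⟨n - 1, by omega⟩ = 0)
    (hne : B ⟨n - i - 1, by omega⟩ ⟨n - 1, by omega⟩ ≠ 0) :
    B = ∑ j ∈ Finset.Icc i (n - 1),
          B ⟨n - j - 1, by omega⟩ ⟨n - 1, by omega⟩ • J ^ j := by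
  have hlast : ∀ r c : Fin n, (c : ℕ) = n - 1 → (c : ℕ) < r + i → B r c = 0 := by
    intro r c hc h
    rcases le_or_gt c r with hcr | hcr
    · exact JordanBlock.apply_eq_zero_of_le hJ hB hcr
    · have hcr' : (r : ℕ) < c := hcr
      have hz := hzero (n - 1 - r) (by omega) (by omega)
      convert hz using 2
      · exact Fin.ext (by simp only; omega)
      · exact Fin.ext hc
  have hband := JordanBlock.apply_eq_zero_of_lt_add hJ hB hlast
  have hsq : B ^ 2 = 0 := by
    ext r c
    rw [sq, Matrix.mul_apply, Matrix.zero_apply]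
    refine Finset.sum_eq_zero fun t _ => ?_
    by_cases h : (t : ℕ) < r + i
    · rw [hband r t h, zero_mul]
    · rw [hband t c (by omega), mul_zero]
  have hcomm : J * B = B * J := sub_eq_zero.1 (hB.trans hsq)
  ext r c
  simp only [Matrix.sum_apply, Matrix.smul_apply, JordanBlock.pow_apply hJ, smul_eq_mul,
    mul_ite, mul_one, mul_zero]
  by_cases h : (c : ℕ) < r + i
  · rw [hband r c h]
    refine (Finset.sum_eq_zero fun j hj => if_neg ?_).symm
    rw [Finset.mem_Icc] at hj
    omega
  · rw [Finset.sum_eq_single ((c : ℕ) - r), if_pos (by omega),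
      ← JordanBlock.apply_add_eq_of_commute hJ hcomm (n - 1 - c) r c (by omega) (by omega)]
    · congr 1
      · exact Fin.ext (by simp only; omega)
      · exact Fin.ext (by simp only; omega)
    · intro j _ hj
      exact if_neg (by omega)
    · intro hj
      exact absurd (Finset.mem_Icc.2 ⟨by omega, by omega⟩) hj
end

section
/- Let k be a field of characteristic zero, n ≥ 2, and let J ∈ M_n(k) be the nilpotent Jordan block (ones on the superdiagonal, zeros elsewhere). Let B ∈ M_n(k) satisfy JB − BJ = B² and suppose b := B_{n−1,n} ≠ 0. Then: (a) 1 + m·b ≠ 0 for every integer m with 1 ≤ m ≤ n−2; and (b) there exists an invertible matrix S ∈ M_n(k) with SJ = JS such that S⁻¹BS is the matrix whose only possibly nonzero entries lie on the superdiagonal and are given by (S⁻¹BS)_{i,i+1} = b/(1 + (n−1−i)·b) for 1 ≤ i ≤ n−1 (in particular (S⁻¹BS)_{n−1,n} = b), all other entries being 0. -/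
/-- If `J` is nilpotent and `[J, B] = B²` in characteristic zero, then `B` is nilpotent, since
`(ad J) ^ m` sends `B` to `m! • B ^ (m + 1)`. -/
theorem isNilpotent_of_commutator_eq_sq_s19 {k A : Type*} [Field k] [CharZero k] [Ring A] [Algebra k A]
    {J B : A} (hJ : IsNilpotent J) (hB : J * B - B * J = B ^ 2) : IsNilpotent B := by
  have hpow (m : ℕ) : J * B ^ m - B ^ m * J = (m : A) * B ^ (m + 1) := by
    induction m with
    | zero => simp
    | succ m ih =>
      have h : J * B ^ (m + 1) - B ^ (m + 1) * J =
          (J * B ^ m - B ^ m * J) * B + B ^ m * (J * B - B * J) := by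
        rw [pow_succ]; noncomm_ring
      rw [h, ih, hB, mul_assoc, ← pow_succ, ← pow_add]
      push_cast
      rw [add_mul, one_mul]
  have had (m : ℕ) : ((LinearMap.mulLeft k J - LinearMap.mulRight k J) ^ m) B =
      (m.factorial : k) • B ^ (m + 1) := by
    induction m with
    | zero => simp
    | succ m ih =>
      rw [pow_succ', Module.End.mul_apply, ih, map_smul, LinearMap.sub_apply,
        LinearMap.mulLeft_apply, LinearMap.mulRight_apply, hpow,
        Nat.factorial_succ, ← nsmul_eq_mul, ← Nat.cast_smul_eq_nsmul k, smul_smul]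
      push_cast
      rw [mul_comm]
  obtain ⟨N, hN⟩ := (LinearMap.commute_mulLeft_right (R := k) J J).isNilpotent_sub
    ((LinearMap.isNilpotent_mulLeft_iff k J).mpr hJ)
    ((LinearMap.isNilpotent_mulRight_iff k J).mpr hJ)
  refine ⟨N + 1, ?_⟩
  have h := had N
  rw [hN, LinearMap.zero_apply, eq_comm, smul_eq_zero] at h
  exact h.resolve_left (Nat.cast_ne_zero.mpr N.factorial_ne_zero)

namespace Matrix

variable {k : Type*} [Field k] {n : ℕ}

/-- The matrix whose only possibly nonzero entries are the `d i` at the positions `(i, i + 1)`. -/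
def superdiagonal (n : ℕ) (d : ℕ → k) : Matrix (Fin n) (Fin n) k :=
  of fun i j => if (i : ℕ) + 1 = j then d i else 0

/-- The vectors supported on the first `m` coordinates. -/
def initialVectors (k : Type*) [Field k] (n m : ℕ) : Submodule k (Fin n → k) where
  carrier := {v | ∀ i : Fin n, m ≤ i → v i = 0}
  add_mem' hv hw i hi := by simp [hv i hi, hw i hi]
  zero_mem' _ _ := rfl
  smul_mem' a v hv i hi := by simp [hv i hi]

theorem initialVectors_mono {l m : ℕ} (h : l ≤ m) :
    initialVectors k n l ≤ initialVectors k n m := fun _ hv i hi => hv i (h.trans hi)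

theorem single_mem_initialVectors {m : ℕ} {j : Fin n} (hj : (j : ℕ) < m) (a : k) :
    Pi.single j a ∈ initialVectors k n m := fun i hi => by
  rw [Pi.single_eq_of_ne (Fin.ne_of_val_ne (hj.trans_le hi).ne')]

theorem superdiagonal_mulVec (d : ℕ → k) (v : Fin n → k) (i : Fin n) :
    (superdiagonal n d *ᵥ v) i = if h : (i : ℕ) + 1 < n then d i * v ⟨i + 1, h⟩ else 0 := by
  simp only [mulVec, dotProduct, superdiagonal, of_apply, ite_mul, zero_mul]
  split_ifs with h
  · rw [Finset.sum_eq_single ⟨i + 1, h⟩]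
    · simp
    · intro j _ hj
      exact if_neg fun e => hj (Fin.ext e.symm)
    · simp
  · exact Finset.sum_eq_zero fun j _ => if_neg (by omega)

theorem mul_superdiagonal_apply (M : Matrix (Fin n) (Fin n) k) (d : ℕ → k) (i j : Fin n) :
    (M * superdiagonal n d) i j =
      if 0 < (j : ℕ) then M i ⟨j - 1, by omega⟩ * d (j - 1) else 0 := by
  simp only [mul_apply, superdiagonal, of_apply, mul_ite, mul_zero]
  split_ifs with h
  · rw [Finset.sum_eq_single ⟨j - 1, by omega⟩]
    · exact if_pos (Nat.sub_add_cancel h)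
    · intro l _ hl
      exact if_neg fun e => hl (Fin.ext (by simp; omega))
    · simp
  · exact Finset.sum_eq_zero fun l _ => if_neg (by omega)

theorem superdiagonal_one_pow_mulVec (s : ℕ) (v : Fin n → k) (i : Fin n) :
    (superdiagonal n (1 : ℕ → k) ^ s *ᵥ v) i =
      if h : (i : ℕ) + s < n then v ⟨i + s, h⟩ else 0 := by
  induction s generalizing i with
  | zero => simp
  | succ s ih =>
    rw [pow_succ', ← mulVec_mulVec, superdiagonal_mulVec]
    by_cases h : (i : ℕ) + 1 < n
    · simp [h, ih, add_assoc, add_comm 1 s]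
    · rw [dif_neg h, dif_neg (by omega)]

theorem superdiagonal_one_pow_mulVec_mem {l m s : ℕ} {v : Fin n → k}
    (hv : v ∈ initialVectors k n m) (h : m ≤ l + s) :
    superdiagonal n (1 : ℕ → k) ^ s *ᵥ v ∈ initialVectors k n l := fun i hi => by
  rw [superdiagonal_one_pow_mulVec]
  split_ifs
  · exact hv _ (by simp; omega)
  · rfl

theorem superdiagonal_one_pow_eq_zero : superdiagonal n (1 : ℕ → k) ^ n = 0 := by
  refine ext_of_mulVec_single fun j => funext fun i => ?_
  rw [superdiagonal_one_pow_mulVec, dif_neg (by omega), zero_mulVec, Pi.zero_apply]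

/-- A multiple of `w` clears the coordinate `m` of `v` when `v` and `w` are supported on the first
`m + 1` coordinates and `w m ≠ 0`. -/
theorem sub_smul_mem_initialVectors {m : ℕ} (hm : m < n) {v w : Fin n → k}
    (hv : v ∈ initialVectors k n (m + 1)) (hw : w ∈ initialVectors k n (m + 1))
    (hwm : w ⟨m, hm⟩ ≠ 0) :
    v - (v ⟨m, hm⟩ / w ⟨m, hm⟩) • w ∈ initialVectors k n m := fun i hi => by
  rcases hi.eq_or_lt with h | h
  · obtain rfl : i = ⟨m, hm⟩ := Fin.ext h.symm
    simp [hwm]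
  · simp [hv i h, hw i h]

section Commutator

variable [CharZero k] {B : Matrix (Fin n) (Fin n) k}
  (hB : superdiagonal n 1 * B - B * superdiagonal n 1 = B ^ 2)

include hB

omit [CharZero k] in
theorem mulVec_superdiagonal_one_mulVec (v : Fin n → k) :
    B *ᵥ (superdiagonal n 1 *ᵥ v) = superdiagonal n 1 *ᵥ (B *ᵥ v) - B *ᵥ (B *ᵥ v) := by
  simp only [mulVec_mulVec, ← sub_mulVec, ← pow_two, ← hB, sub_sub_cancel]

theorem mulVec_mem_initialVectors_step {m : ℕ} (hm : m < n)
    (h : ∀ v ∈ initialVectors k n m, B *ᵥ v ∈ initialVectors k n m) {v : Fin n → k}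
    (hv : v ∈ initialVectors k n (m + 1)) : B *ᵥ v ∈ initialVectors k n m := by
  have hJV (w : Fin n → k) (hw : w ∈ initialVectors k n m) :
      superdiagonal n 1 *ᵥ w ∈ initialVectors k n m := by
    simpa using superdiagonal_one_pow_mulVec_mem (s := 1) hw (by omega)
  obtain ⟨N, hN⟩ := isNilpotent_of_commutator_eq_sq_s19 (k := k)
    ⟨n, superdiagonal_one_pow_eq_zero⟩ hB
  obtain ⟨w, hBw, hw⟩ : ∃ w, B *ᵥ w ∈ initialVectors k n m ∧ w ∉ initialVectors k n m := by
    by_contra! hcon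
    have hpow (s : ℕ) (w : Fin n → k) (hw : B ^ s *ᵥ w ∈ initialVectors k n m) :
        w ∈ initialVectors k n m := by
      induction s with
      | zero => simpa using hw
      | succ s ih =>
        rw [pow_succ', ← mulVec_mulVec] at hw
        exact ih (hcon _ hw)
    have h1 := hpow N (Pi.single ⟨m, hm⟩ 1)
      (by rw [hN, zero_mulVec]; exact zero_mem _) ⟨m, hm⟩ le_rfl
    simp at h1
  have hBJ (s : ℕ) : B *ᵥ (superdiagonal n 1 ^ s *ᵥ w) ∈ initialVectors k n m := by
    induction s with
    | zero => simpa using hBw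
    | succ s ih =>
      rw [pow_succ', ← mulVec_mulVec, mulVec_superdiagonal_one_mulVec hB]
      exact sub_mem (hJV _ ih) (h _ ih)
  obtain ⟨s, hs, hs'⟩ : ∃ s, superdiagonal n 1 ^ s *ᵥ w ∉ initialVectors k n m ∧
      superdiagonal n 1 ^ (s + 1) *ᵥ w ∈ initialVectors k n m := by
    by_contra! hcon
    have hall (s : ℕ) : superdiagonal n 1 ^ s *ᵥ w ∉ initialVectors k n m := by
      induction s with
      | zero => simpa using hw
      | succ s ih => exact hcon s ih
    exact hall n (by simp [superdiagonal_one_pow_eq_zero])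
  set w' := superdiagonal n 1 ^ s *ᵥ w with hw'
  rw [pow_succ', ← mulVec_mulVec, ← hw'] at hs'
  have hmem : w' ∈ initialVectors k n (m + 1) := fun i hi => by
    have h1 := hs' ⟨i - 1, by omega⟩ (by simp; omega)
    rw [superdiagonal_mulVec, dif_pos (by simp; omega)] at h1
    simpa [Nat.sub_add_cancel (by omega : 1 ≤ (i : ℕ))] using h1
  have hne : w' ⟨m, hm⟩ ≠ 0 := fun h0 => hs fun i hi => by
    rcases hi.eq_or_lt with h1 | h1
    · rw [← h0]; exact congrArg w' (Fin.ext h1.symm)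
    · exact hmem i h1
  have h2 := h _ (sub_smul_mem_initialVectors hm hv hmem hne)
  rw [mulVec_sub, mulVec_smul] at h2
  exact ((initialVectors k n m).sub_mem_iff_left (Submodule.smul_mem _ _ (hBJ s))).mp h2

theorem mulVec_mem_initialVectors {m : ℕ} (hm : m ≤ n) {v : Fin n → k}
    (hv : v ∈ initialVectors k n m) : B *ᵥ v ∈ initialVectors k n (m - 1) := by
  induction m generalizing v with
  | zero =>
    obtain rfl : v = 0 := funext fun i => hv i (Nat.zero_le _)
    simp
  | succ m ih =>
    exact mulVec_mem_initialVectors_step hB hm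
      (fun w hw => initialVectors_mono (Nat.sub_le m 1) (ih (by omega) hw)) hv

theorem apply_eq_zero_of_le {i j : Fin n} (hij : j ≤ i) : B i j = 0 := by
  have h := mulVec_mem_initialVectors hB j.isLt
    (single_mem_initialVectors (Nat.lt_succ_self (j : ℕ)) 1) i (by simpa using hij)
  simpa using h

theorem superdiagonal_entry_recursion {i : ℕ} (hi : i + 2 < n) :
    B ⟨i, by omega⟩ ⟨i + 1, by omega⟩ =
      B ⟨i + 1, by omega⟩ ⟨i + 2, hi⟩ * (1 - B ⟨i, by omega⟩ ⟨i + 1, by omega⟩) := by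
  have h : (superdiagonal n 1 * B - B * superdiagonal n 1 : Matrix (Fin n) (Fin n) k)
      ⟨i, by omega⟩ ⟨i + 2, hi⟩ = (B ^ 2) ⟨i, by omega⟩ ⟨i + 2, hi⟩ := by rw [hB]
  have h1 : (superdiagonal n 1 * B : Matrix (Fin n) (Fin n) k) ⟨i, by omega⟩ ⟨i + 2, hi⟩ =
      B ⟨i + 1, by omega⟩ ⟨i + 2, hi⟩ := by
    have h2 := superdiagonal_mulVec 1 (B.col ⟨i + 2, hi⟩) ⟨i, by omega⟩
    rw [dif_pos (by simp; omega)] at h2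
    exact h2.trans (by simp)
  rw [sub_apply, h1, mul_superdiagonal_apply, if_pos (by simp), pow_two, mul_apply,
    Finset.sum_eq_single ⟨i + 1, by omega⟩] at h
  · simp at h
    linear_combination -h
  · intro l _ hl
    rcases lt_or_gt_of_ne hl with h2 | h2
    · rw [apply_eq_zero_of_le hB (Nat.lt_succ_iff.mp h2), zero_mul]
    · rw [apply_eq_zero_of_le hB (i := l) (Nat.succ_le_of_lt h2), mul_zero]
  · simp

theorem superdiagonal_entry_mul {m : ℕ} (hm : m + 2 ≤ n) :
    B ⟨n - 2 - m, by omega⟩ ⟨n - 1 - m, by omega⟩ *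
        (1 + (m : k) * B ⟨n - 2, by omega⟩ ⟨n - 1, by omega⟩) =
      B ⟨n - 2, by omega⟩ ⟨n - 1, by omega⟩ := by
  induction m with
  | zero => simp
  | succ m ih =>
    have h := superdiagonal_entry_recursion hB (i := n - 2 - (m + 1)) (by omega)
    have e1 : n - 2 - (m + 1) + 1 = n - 2 - m := by omega
    have e2 : n - 2 - (m + 1) + 2 = n - 1 - m := by omega
    have e3 : n - 1 - (m + 1) = n - 2 - m := by omega
    have ih := ih (by omega)
    simp only [e1, e2] at h
    simp only [e3]
    push_cast
    set b := B ⟨n - 2, by omega⟩ ⟨n - 1, by omega⟩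
    linear_combination (1 + m * b) * h +
      (1 - B ⟨n - 2 - (m + 1), by omega⟩ ⟨n - 2 - m, by omega⟩) * ih

theorem one_add_mul_ne_zero (hn : 1 < n) (hb : B ⟨n - 2, by omega⟩ ⟨n - 1, by omega⟩ ≠ 0)
    {m : ℕ} (hm : m ≤ n - 2) :
    1 + (m : k) * B ⟨n - 2, by omega⟩ ⟨n - 1, by omega⟩ ≠ 0 := fun h => by
  have h1 := superdiagonal_entry_mul hB (m := m) (by omega)
  rw [h, mul_zero] at h1
  exact hb h1.symm

theorem superdiagonal_entry_eq (hn : 1 < n) (hb : B ⟨n - 2, by omega⟩ ⟨n - 1, by omega⟩ ≠ 0)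
    {i : ℕ} (hi : i + 1 < n) :
    B ⟨i, by omega⟩ ⟨i + 1, hi⟩ = B ⟨n - 2, by omega⟩ ⟨n - 1, by omega⟩ /
      (1 + ((n - 2 - i : ℕ) : k) * B ⟨n - 2, by omega⟩ ⟨n - 1, by omega⟩) := by
  rw [eq_div_iff (one_add_mul_ne_zero hB hn hb (Nat.sub_le _ _))]
  have h := superdiagonal_entry_mul hB (m := n - 2 - i) (by omega)
  have e1 : n - 2 - (n - 2 - i) = i := by omega
  have e2 : n - 1 - (n - 2 - i) = i + 1 := by omega
  simpa only [e1, e2] using h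

/-- `B v = b J v` for some vector `v` whose last coordinate is `1`. -/
theorem exists_mulVec_eq_smul (hn : 1 < n) (hb : B ⟨n - 2, by omega⟩ ⟨n - 1, by omega⟩ ≠ 0) :
    ∃ v : Fin n → k, v ⟨n - 1, by omega⟩ = 1 ∧
      B *ᵥ v = B ⟨n - 2, by omega⟩ ⟨n - 1, by omega⟩ • (superdiagonal n 1 *ᵥ v) := by
  set b := B ⟨n - 2, by omega⟩ ⟨n - 1, by omega⟩ with hbdef
  set T := B - b • superdiagonal n 1 with hT
  have hTmul (v : Fin n → k) : T *ᵥ v = B *ᵥ v - b • (superdiagonal n 1 *ᵥ v) := by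
    rw [hT, sub_mulVec, smul_mulVec]
  have hTmem {m : ℕ} (hm : m + 1 ≤ n) {v : Fin n → k} (hv : v ∈ initialVectors k n (m + 1)) :
      T *ᵥ v ∈ initialVectors k n m := by
    rw [hTmul]
    refine sub_mem (mulVec_mem_initialVectors hB hm hv) (Submodule.smul_mem _ _ ?_)
    simpa using superdiagonal_one_pow_mulVec_mem (s := 1) hv le_rfl
  have hTne {m : ℕ} (hm : m + 2 < n) : T ⟨m, by omega⟩ ⟨m + 1, by omega⟩ ≠ 0 := by
    have h1 := one_add_mul_ne_zero hB hn hb (m := n - 2 - m) (Nat.sub_le _ _)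
    have h2 : ((n - 2 - m : ℕ) : k) ≠ 0 := Nat.cast_ne_zero.mpr (by omega)
    rw [hT, sub_apply, superdiagonal_entry_eq hB hn hb (by omega), smul_apply, superdiagonal,
      of_apply, if_pos rfl, Pi.one_apply, smul_eq_mul, mul_one, sub_ne_zero, ← hbdef]
    rw [← hbdef] at h1
    intro h
    rw [div_eq_iff h1] at h
    have h3 : ((n - 2 - m : ℕ) : k) * (b * b) = 0 := by linear_combination -h
    exact mul_ne_zero h2 (mul_ne_zero hb hb) h3
  have hsurj {m : ℕ} (hm : m + 2 ≤ n) {w : Fin n → k} (hw : w ∈ initialVectors k n m) :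
      ∃ v ∈ initialVectors k n (m + 1), T *ᵥ v = w := by
    induction m generalizing w with
    | zero =>
      refine ⟨0, zero_mem _, ?_⟩
      rw [mulVec_zero]
      exact funext fun i => (hw i (Nat.zero_le _)).symm
    | succ m ih =>
      have hm' : m + 1 < n := by omega
      have hs := single_mem_initialVectors (j := ⟨m + 1, hm'⟩) (Nat.lt_succ_self (m + 1)) (1 : k)
      have hTs := hTmem (by omega) hs
      obtain ⟨v, hv, hTv⟩ := ih (by omega) (sub_smul_mem_initialVectors (m := m) (by omega) hw hTs
        (by simpa using hTne (by omega)))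
      refine ⟨_, add_mem (initialVectors_mono (Nat.le_succ _) hv) (Submodule.smul_mem _
        (w ⟨m, by omega⟩ / (T *ᵥ Pi.single ⟨m + 1, hm'⟩ 1) ⟨m, by omega⟩) hs), ?_⟩
      rw [mulVec_add, mulVec_smul, hTv, sub_add_cancel]
  have hlast : T *ᵥ Pi.single ⟨n - 1, by omega⟩ 1 ∈ initialVectors k n (n - 2) := fun i hi => by
    rw [mulVec_single_one, col_apply]
    rcases hi.eq_or_lt with h | h
    · have hi' : i = ⟨n - 2, by omega⟩ := Fin.ext h.symm
      have e : n - 2 + 1 = n - 1 := by omega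
      simp [hi', hT, superdiagonal, e, ← hbdef]
    · have hi' : i = ⟨n - 1, by omega⟩ := Fin.ext (by simp; omega)
      simp [hi', hT, superdiagonal, apply_eq_zero_of_le hB]
  obtain ⟨v, hv, hTv⟩ := hsurj (by omega) hlast
  refine ⟨Pi.single ⟨n - 1, by omega⟩ 1 - v, ?_, ?_⟩
  · simp [hv ⟨n - 1, by omega⟩ (by simp; omega)]
  · rw [← sub_eq_zero, ← hTmul, mulVec_sub, hTv, sub_self]

theorem mulVec_superdiagonal_one_pow_mulVec {b : k} {v : Fin n → k}
    (hv : B *ᵥ v = b • (superdiagonal n 1 *ᵥ v)) (hb : ∀ m ≤ n - 2, 1 + (m : k) * b ≠ 0)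
    {m : ℕ} (hm : m ≤ n - 2) :
    B *ᵥ (superdiagonal n 1 ^ m *ᵥ v) =
      (b / (1 + m * b)) • (superdiagonal n 1 ^ (m + 1) *ᵥ v) := by
  induction m with
  | zero => simpa using hv
  | succ m ih =>
    have h0 := hb m (by omega)
    have h1 := hb (m + 1) hm
    have h := mulVec_superdiagonal_one_mulVec hB (superdiagonal n 1 ^ m *ᵥ v)
    rw [ih (by omega), mulVec_smul, mulVec_smul, mulVec_mulVec _ _ (superdiagonal n 1 ^ m),
      mulVec_mulVec _ _ (superdiagonal n 1 ^ (m + 1)), ← pow_succ', ← pow_succ'] at h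
    ext i
    have hi := congrFun h i
    simp only [Pi.sub_apply, Pi.smul_apply, smul_eq_mul] at hi ⊢
    push_cast at h1 ⊢
    have hc : b / (1 + m * b) * (1 + m * b) = b := div_mul_cancel₀ _ h0
    rw [div_mul_eq_mul_div, eq_div_iff h1]
    linear_combination (1 + m * b) * hi +
      ((superdiagonal n 1 ^ (m + 1 + 1) *ᵥ v) i - (B *ᵥ superdiagonal n 1 ^ (m + 1) *ᵥ v) i) * hc

end Commutator

/-- The matrix with columns `J ^ (n - 1) v, …, J v, v`, for `J` the nilpotent Jordan block. -/
def shiftMatrix (v : Fin n → k) : Matrix (Fin n) (Fin n) k :=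
  of fun i j => (superdiagonal n 1 ^ (n - 1 - j) *ᵥ v) i

theorem mul_shiftMatrix_apply (M : Matrix (Fin n) (Fin n) k) (v : Fin n → k) (i j : Fin n) :
    (M * shiftMatrix v) i j = (M *ᵥ (superdiagonal n 1 ^ (n - 1 - j) *ᵥ v)) i := rfl

theorem shiftMatrix_mul_superdiagonal_one (v : Fin n → k) :
    shiftMatrix v * superdiagonal n 1 = superdiagonal n 1 * shiftMatrix v := by
  ext i j
  rw [mul_superdiagonal_apply, mul_shiftMatrix_apply, mulVec_mulVec, ← pow_succ']
  split_ifs with h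
  · simp [shiftMatrix, show n - 1 - (j - 1) = n - 1 - j + 1 by omega]
  · rw [show n - 1 - (j : ℕ) + 1 = n by omega, superdiagonal_one_pow_eq_zero, zero_mulVec,
      Pi.zero_apply]

theorem isUnit_shiftMatrix (hn : 0 < n) {v : Fin n → k} (hv : v ⟨n - 1, by omega⟩ ≠ 0) :
    IsUnit (shiftMatrix v) := by
  rw [isUnit_iff_isUnit_det, det_of_isUpperTriangular, isUnit_iff_ne_zero]
  · refine Finset.prod_ne_zero_iff.mpr fun i _ => ?_
    have e : (i : ℕ) + (n - 1 - i) = n - 1 := by omega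
    rw [shiftMatrix, of_apply, superdiagonal_one_pow_mulVec, dif_pos (by omega)]
    simpa only [e] using hv
  · intro i j hij
    have hij : (j : ℕ) < i := hij
    rw [shiftMatrix, of_apply, superdiagonal_one_pow_mulVec, dif_neg (by omega)]

end Matrix

theorem stmt_19 (k : Type*) [Field k] [CharZero k] (n : ℕ) (hn : 2 ≤ n)
    (J B : Matrix (Fin n) (Fin n) k)
    (hJ : ∀ i j : Fin n, J i j = if (i : ℕ) + 1 = (j : ℕ) then 1 else 0)
    (hB : J * B - B * J = B ^ 2)
    (hb : B ⟨n - 2, by omega⟩ ⟨n - 1, by omega⟩ ≠ 0) :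
    (∀ m : ℕ, 1 ≤ m → m ≤ n - 2 →
      (1 : k) + (m : k) * B ⟨n - 2, by omega⟩ ⟨n - 1, by omega⟩ ≠ 0) ∧
    (∃ S : Matrix (Fin n) (Fin n) k, IsUnit S ∧ S * J = J * S ∧
      ∀ i j : Fin n, (S⁻¹ * B * S) i j =
        if (i : ℕ) + 1 = (j : ℕ) then
          B ⟨n - 2, by omega⟩ ⟨n - 1, by omega⟩ /
            (1 + ((n - 2 - (i : ℕ) : ℕ) : k) * B ⟨n - 2, by omega⟩ ⟨n - 1, by omega⟩)
        else 0) := by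
  obtain rfl : J = Matrix.superdiagonal n 1 := by
    ext i j
    rw [hJ, Matrix.superdiagonal, Matrix.of_apply, Pi.one_apply]
  have hne (m : ℕ) (hm : m ≤ n - 2) := Matrix.one_add_mul_ne_zero hB hn hb hm
  refine ⟨fun m _ hm => hne m hm, ?_⟩
  obtain ⟨v, hv1, hv⟩ := Matrix.exists_mulVec_eq_smul hB hn hb
  set b := B ⟨n - 2, by omega⟩ ⟨n - 1, by omega⟩
  have hunit := Matrix.isUnit_shiftMatrix (by omega) (hv1.trans_ne one_ne_zero)
  refine ⟨Matrix.shiftMatrix v, hunit, Matrix.shiftMatrix_mul_superdiagonal_one v, ?_⟩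
  have hBS : B * Matrix.shiftMatrix v = Matrix.shiftMatrix v *
      Matrix.superdiagonal n (fun i => b / (1 + ((n - 2 - i : ℕ) : k) * b)) := by
    ext i j
    rw [Matrix.mul_shiftMatrix_apply, Matrix.mul_superdiagonal_apply]
    split_ifs with h
    · rw [Matrix.mulVec_superdiagonal_one_pow_mulVec hB hv hne (by omega), Pi.smul_apply,
        smul_eq_mul, mul_comm, Matrix.shiftMatrix, Matrix.of_apply,
        show n - 2 - ((j : ℕ) - 1) = n - 1 - j by omega]
      simp only [show n - 1 - ((j : ℕ) - 1) = n - 1 - j + 1 by omega]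
    · have hmem := Matrix.superdiagonal_one_pow_mulVec_mem (v := v) (l := 1) (m := n)
        (s := n - 1 - j) (fun i hi => absurd i.isLt (by omega)) (by omega)
      exact Matrix.mulVec_mem_initialVectors hB (by omega) hmem i (Nat.zero_le _)
  intro i j
  rw [mul_assoc, hBS, Matrix.nonsing_inv_mul_cancel_left _ _
    ((Matrix.isUnit_iff_isUnit_det _).mp hunit), Matrix.superdiagonal, Matrix.of_apply]
end
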